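/- arXiv:2106.08093 — 5 statements merged into one kernel-verified Lean document; each statement's English description precedes it below -/
import Mathlib

section
/- For every x ∈ ℝ, the restricted Fenchel–Legendre transform sup_{λ < θ} { λx − φ(λ) } equals I(x) if x ≤ φ'(θ), and equals θx − φ(θ) if x ≥ φ'(θ). -/
open MeasureTheory ProbabilityTheory Filter Set

theorem ConvexOn.add_deriv_mul_sub_le {f : ℝ → ℝ} (hf : ConvexOn ℝ univ f) {a : ℝ}
    (ha : DifferentiableAt ℝ f a) (b : ℝ) : f a + deriv f a * (b - a) ≤ f b := by
  rcases lt_trichotomy a b with h | rfl | h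
  · have := hf.deriv_le_slope (mem_univ a) (mem_univ b) h ha
    rw [slope_def_field, le_div_iff₀ (sub_pos.2 h)] at this
    linarith
  · simp
  · have := hf.slope_le_deriv (mem_univ b) (mem_univ a) h ha
    rw [slope_def_field, div_le_iff₀ (sub_pos.2 h)] at this
    linarith

theorem ContinuousAt.coe_le_iSup_lt {f : ℝ → ℝ} {a : ℝ} (hf : ContinuousAt f a) :
    (f a : EReal) ≤ ⨆ (l : ℝ) (_ : l < a), (f l : EReal) := by
  have h : Tendsto (fun l => (f l : EReal)) (nhdsWithin a (Iio a)) (nhds (f a : EReal)) :=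
    ((continuous_coe_real_ereal.tendsto _).comp hf).mono_left nhdsWithin_le_nhds
  refine le_of_tendsto h ?_
  filter_upwards [self_mem_nhdsWithin] with l hl
  exact le_iSup₂_of_le l hl le_rfl

/-- The restricted Fenchel–Legendre transform `sup_{λ < θ} {λx − φ(λ)}` equals `I(x)`
for `x ≤ φ'(θ)` and equals `θx − φ(θ)` for `x ≥ φ'(θ)`, where `φ = log m` is the
log-moment generating function of a non-degenerate random variable `X` with
everywhere-finite mgf, and `I` is its Fenchel–Legendre transform. -/
theorem restricted_legendre_transform
    {Ω : Type*} [MeasurableSpace Ω] (P : Measure Ω) [IsProbabilityMeasure P]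
    (X : Ω → ℝ) (hXmeas : Measurable X)
    (hnondeg : ∀ t : ℝ, P {ω | X ω = t} < 1)
    (hmgf : ∀ l : ℝ, Integrable (fun ω => Real.exp (l * X ω)) P)
    (φ : ℝ → ℝ) (hφ : φ = fun l => Real.log (∫ ω, Real.exp (l * X ω) ∂P))
    (hφdiff : Differentiable ℝ φ) (hφconv : StrictConvexOn ℝ Set.univ φ)
    (I : ℝ → EReal) (hI : I = fun x => ⨆ l : ℝ, ((l * x - φ l : ℝ) : EReal))
    (θ : ℝ) (hθ : 0 < θ) (x : ℝ) :
    (x ≤ deriv φ θ →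
      (⨆ (l : ℝ) (_ : l < θ), ((l * x - φ l : ℝ) : EReal)) = I x) ∧
    (deriv φ θ ≤ x →
      (⨆ (l : ℝ) (_ : l < θ), ((l * x - φ l : ℝ) : EReal)) = ((θ * x - φ θ : ℝ) : EReal)) := by
  have tangent := hφconv.convexOn.add_deriv_mul_sub_le (hφdiff θ)
  have endpoint : ((θ * x - φ θ : ℝ) : EReal) ≤
      ⨆ (l : ℝ) (_ : l < θ), ((l * x - φ l : ℝ) : EReal) :=
    ContinuousAt.coe_le_iSup_lt (f := fun l => l * x - φ l)
      ((continuous_id.mul continuous_const).sub hφdiff.continuous).continuousAt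
  subst hI
  refine ⟨fun hx => le_antisymm (iSup_mono fun l => iSup_le fun _ => le_rfl) ?_,
    fun hx => le_antisymm ?_ endpoint⟩
  · refine iSup_le fun l => ?_
    rcases lt_or_ge l θ with hl | hl
    · exact le_iSup₂_of_le (f := fun (l : ℝ) (_ : l < θ) => ((l * x - φ l : ℝ) : EReal))
        l hl le_rfl
    · refine le_trans (EReal.coe_le_coe_iff.2 ?_) endpoint
      nlinarith [tangent l, mul_nonneg (sub_nonneg.2 hx) (sub_nonneg.2 hl)]
  · refine iSup₂_le fun l hl => EReal.coe_le_coe_iff.2 ?_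
    nlinarith [tangent l, mul_nonneg (sub_nonneg.2 hx) (sub_nonneg.2 hl.le)]
end

section
/- For all real numbers c, x with x < c and every ρ ∈ [0,∞), the following identity of extended reals holds: inf_{0 < t ≤ 1} { ρ t + t · I( (x − (1−t)c)/t ) } = (c − x) · inf_{y ≤ x} ( ρ + I(y) ) / ( c − y ), where both sides may equal +∞. -/
open MeasureTheory Filter Set

theorem EReal.coe_mul_coe_add_mul_coe {a b : ℝ} (ha : 0 < a) (hb : 0 < b) (r : ℝ)
    {u : EReal} (hu : 0 ≤ u) :
    (a : EReal) * (((r : EReal) + u) * (b : EReal))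
      = ((r * (a * b) : ℝ) : EReal) + ((a * b : ℝ) : EReal) * u := by
  induction u with
  | bot => simp at hu
  | coe v => norm_cast; ring
  | top =>
    rw [EReal.coe_add_top, EReal.top_mul_coe_of_pos hb, EReal.coe_mul_top_of_pos ha,
      EReal.coe_mul_top_of_pos (mul_pos ha hb), EReal.coe_add_top]

/-- For `x < c` and `ρ ∈ [0,∞)`, the identity of extended reals
`inf_{0 < t ≤ 1} { ρt + t·I((x − (1−t)c)/t) }
  = (c − x) · inf_{y ≤ x} (ρ + I(y))/(c − y)`,
where `I` is the Fenchel–Legendre transform of the log-mgf `φ` of a non-degenerate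
random variable with everywhere-finite mgf; both sides may equal `+∞`. -/
theorem lower_deviation_rate_infimum_identity
    {Ω : Type*} [MeasurableSpace Ω] (P : Measure Ω) [IsProbabilityMeasure P]
    (X : Ω → ℝ) (hXmeas : Measurable X)
    (hnondeg : ∀ t : ℝ, P {ω | X ω = t} < 1)
    (hmgf : ∀ l : ℝ, Integrable (fun ω => Real.exp (l * X ω)) P)
    (φ : ℝ → ℝ) (hφ : φ = fun l => Real.log (∫ ω, Real.exp (l * X ω) ∂P))
    (I : ℝ → EReal) (hI : I = fun x => ⨆ l : ℝ, ((l * x - φ l : ℝ) : EReal))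
    (c x ρ : ℝ) (hxc : x < c) (hρ : 0 ≤ ρ) :
    (⨅ (t : ℝ) (_ : 0 < t) (_ : t ≤ 1),
        (((ρ * t : ℝ) : EReal) + (t : EReal) * I ((x - (1 - t) * c) / t)))
      = ((c - x : ℝ) : EReal) *
          ⨅ (y : ℝ) (_ : y ≤ x), (((ρ : ℝ) : EReal) + I y) * (((c - y)⁻¹ : ℝ) : EReal) := by
  have hI0 : ∀ y, 0 ≤ I y := by
    intro y
    rw [hI]
    refine le_trans ?_ (le_iSup _ (0 : ℝ))
    simp [hφ]
  have ha : 0 < c - x := sub_pos.2 hxc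
  have hterm : ∀ y ≤ x, ((c - x : ℝ) : EReal) *
      ((((ρ : ℝ) : EReal) + I y) * (((c - y)⁻¹ : ℝ) : EReal)) =
      ((ρ * ((c - x) * (c - y)⁻¹) : ℝ) : EReal) + (((c - x) * (c - y)⁻¹ : ℝ) : EReal) * I y :=
    fun y hy => EReal.coe_mul_coe_add_mul_coe ha (inv_pos.2 (by linarith)) ρ (hI0 y)
  apply le_antisymm
  · rw [← EReal.div_le_iff_le_mul (by exact_mod_cast ha) (EReal.coe_ne_top _)]
    refine le_iInf₂ fun y hy => ?_
    have hcy : 0 < c - y := by linarith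
    rw [EReal.div_le_iff_le_mul (by exact_mod_cast ha) (EReal.coe_ne_top _),
      hterm y hy]
    refine (iInf_le _ ((c - x) * (c - y)⁻¹)).trans
      ((iInf₂_le (by positivity) ?_).trans_eq ?_)
    · rw [← div_eq_mul_inv, div_le_one hcy]
      linarith
    · congr 3
      field_simp
      ring
  · refine le_iInf fun t => le_iInf₂ fun ht ht1 => ?_
    have hcy : c - (x - (1 - t) * c) / t = (c - x) / t := by
      field_simp
      ring
    have hy : (x - (1 - t) * c) / t ≤ x := by
      rw [div_le_iff₀ ht]
      nlinarith
    refine (mul_le_mul_of_nonneg_left (iInf₂_le ((x - (1 - t) * c) / t) hy)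
      (EReal.coe_nonneg.2 ha.le)).trans_eq ?_
    have htt : (c - x) * (c - (x - (1 - t) * c) / t)⁻¹ = t := by
      rw [hcy]
      field_simp
    rw [hterm _ hy, htt]
end

section
/- Let c, x be real numbers with x < c and c > E[X]. Then the map t ↦ I( (x − (1−t)c)/t ) is non-decreasing on the set of t satisfying (c − x)/(c − E[X]) ≤ t ≤ 1. -/
open MeasureTheory Filter Set

/-- A random variable with finite exponential moments at `1` and `-1` is integrable. -/
theorem integrable_of_integrable_exp {Ω : Type*} [MeasurableSpace Ω] {P : Measure Ω}
    {X : Ω → ℝ} (hX : AEStronglyMeasurable X P)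
    (hpos : Integrable (fun ω => Real.exp (X ω)) P)
    (hneg : Integrable (fun ω => Real.exp (-X ω)) P) : Integrable X P := by
  refine (hpos.add hneg).mono' hX (Eventually.of_forall fun ω => ?_)
  have h1 := Real.add_one_le_exp (X ω)
  have h2 := Real.add_one_le_exp (-X ω)
  have h3 := Real.exp_pos (X ω)
  have h4 := Real.exp_pos (-X ω)
  simp only [Pi.add_apply, Real.norm_eq_abs]
  exact abs_le.2 ⟨by linarith, by linarith⟩

/-- Jensen's inequality for the log-moment generating function. -/
theorem mul_integral_le_log_integral_exp {Ω : Type*} [MeasurableSpace Ω] {P : Measure Ω}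
    [IsProbabilityMeasure P] {X : Ω → ℝ} (hX : Integrable X P) (l : ℝ)
    (hexp : Integrable (fun ω => Real.exp (l * X ω)) P) :
    l * ∫ ω, X ω ∂P ≤ Real.log (∫ ω, Real.exp (l * X ω) ∂P) := by
  rw [Real.le_log_iff_exp_le (integral_exp_pos hexp), ← integral_const_mul]
  exact convexOn_exp.map_integral_le Real.continuous_exp.continuousOn isClosed_univ
    (Eventually.of_forall fun _ => mem_univ _) (hX.const_mul l) hexp

/-- If `φ 0 = 0` and `φ` lies above the line of slope `m` through the origin, then its
Fenchel–Legendre transform is non-decreasing on `[m, ∞)`. -/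
theorem monotoneOn_legendre_transform {φ : ℝ → ℝ} {m : ℝ} (hzero : φ 0 = 0)
    (hle : ∀ l, l * m ≤ φ l) :
    MonotoneOn (fun x : ℝ => ⨆ l : ℝ, ((l * x - φ l : ℝ) : EReal)) (Set.Ici m) := by
  intro y hy z _ hyz
  refine iSup_le fun l => ?_
  rcases le_total 0 l with hl | hl
  · refine le_iSup_of_le l (EReal.coe_le_coe_iff.2 ?_)
    gcongr
  · refine le_iSup_of_le 0 (EReal.coe_le_coe_iff.2 ?_)
    have := mul_le_mul_of_nonpos_left (mem_Ici.1 hy) hl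
    linarith [hle l]

/-- For real numbers `c, x` with `x < c` and `c > E[X]`, the map
`t ↦ I((x − (1−t)c)/t)` is non-decreasing on `{t : (c − x)/(c − E[X]) ≤ t ≤ 1}`,
where `I` is the Fenchel–Legendre transform of the log-mgf of `X`. -/
theorem rate_argument_monotone
    {Ω : Type*} [MeasurableSpace Ω] (P : Measure Ω) [IsProbabilityMeasure P]
    (X : Ω → ℝ) (hXmeas : Measurable X)
    (hnondeg : ∀ t : ℝ, P {ω | X ω = t} < 1)
    (hmgf : ∀ l : ℝ, Integrable (fun ω => Real.exp (l * X ω)) P)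
    (φ : ℝ → ℝ) (hφ : φ = fun l => Real.log (∫ ω, Real.exp (l * X ω) ∂P))
    (I : ℝ → EReal) (hI : I = fun x => ⨆ l : ℝ, ((l * x - φ l : ℝ) : EReal))
    (EX : ℝ) (hEX : EX = ∫ ω, X ω ∂P)
    (c x : ℝ) (hxc : x < c) (hcEX : EX < c) :
    MonotoneOn (fun t : ℝ => I ((x - (1 - t) * c) / t))
      (Set.Icc ((c - x) / (c - EX)) 1) := by
  have hX : Integrable X P := integrable_of_integrable_exp hXmeas.aestronglyMeasurable
    (by simpa using hmgf 1) (by simpa using hmgf (-1))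
  have hmono : MonotoneOn I (Set.Ici EX) := by
    rw [hI]
    refine monotoneOn_legendre_transform (by simp [hφ]) fun l => ?_
    rw [hφ, hEX]
    exact mul_integral_le_log_integral_exp hX l (hmgf l)
  have hpos : ∀ t ∈ Set.Icc ((c - x) / (c - EX)) 1, 0 < t := fun t ht =>
    (div_pos (sub_pos.2 hxc) (sub_pos.2 hcEX)).trans_le ht.1
  have harg : ∀ t : ℝ, 0 < t → (x - (1 - t) * c) / t = c - (c - x) / t := by
    intro t ht
    field_simp
    ring
  have hargmono : MonotoneOn (fun t : ℝ => (x - (1 - t) * c) / t)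
      (Set.Icc ((c - x) / (c - EX)) 1) := by
    intro s hs t ht hst
    have hs0 := hpos s hs
    simp only [harg s hs0, harg t (hpos t ht)]
    have hcx : 0 ≤ c - x := sub_nonneg.2 hxc.le
    gcongr
  refine hmono.comp hargmono fun t ht => ?_
  have h : (c - x) / t ≤ c - EX := (div_le_comm₀ (sub_pos.2 hcEX) (hpos t ht)).1 ht.1
  rw [mem_Ici, harg t (hpos t ht)]
  linarith
end

section
/- For every x with essinf X < x < esssup X, there exists a unique λ ∈ ℝ with φ'(λ) = x; moreover I(x) = λ x − φ(λ), and I is differentiable at x with I'(x) = λ, i.e. I' = (φ')^{−1} on the interior of the effective domain of I. -/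
open MeasureTheory Filter Set

section LegendreTransform

/-- The Fenchel–Legendre transform of `f`, with values in the extended reals. -/
noncomputable def legendreTransform (f : ℝ → ℝ) (y : ℝ) : EReal :=
  ⨆ l : ℝ, ((l * y - f l : ℝ) : EReal)

variable {f : ℝ → ℝ}

lemma add_deriv_mul_sub_le (hf : Differentiable ℝ f) (hmono : StrictMono (deriv f)) (k l : ℝ) :
    f k + deriv f k * (l - k) ≤ f l := by
  have hconv : ConvexOn ℝ univ f := hmono.monotone.convexOn_univ_of_deriv hf
  rcases lt_trichotomy k l with h | rfl | h
  · have := hconv.le_slope_of_hasDerivAt (mem_univ k) (mem_univ l) h (hf k).hasDerivAt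
    rw [slope_def_field, le_div_iff₀ (sub_pos.2 h)] at this
    linarith
  · simp
  · have := hconv.slope_le_of_hasDerivAt (mem_univ l) (mem_univ k) h (hf k).hasDerivAt
    rw [slope_def_field, div_le_iff₀ (sub_pos.2 h)] at this
    linarith

lemma legendreTransform_deriv (hf : Differentiable ℝ f) (hmono : StrictMono (deriv f)) (k : ℝ) :
    legendreTransform f (deriv f k) = ((k * deriv f k - f k : ℝ) : EReal) := by
  refine le_antisymm (iSup_le fun l => ?_)
    (le_iSup (fun l : ℝ => ((l * deriv f k - f l : ℝ) : EReal)) k)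
  rw [EReal.coe_le_coe_iff]
  linarith [add_deriv_mul_sub_le hf hmono k l]

/-- The Legendre transform has derivative `l` at `f' l`. -/
lemma hasDerivAt_legendreTransform (hf : Differentiable ℝ f) (hmono : StrictMono (deriv f))
    (hcont : Continuous (deriv f)) (l : ℝ) :
    HasDerivAt (fun y => (legendreTransform f y).toReal) l (deriv f l) := by
  rw [hasDerivAt_iff_isLittleO, Asymptotics.isLittleO_iff]
  intro c hc
  have hnhds : Ioo (deriv f (l - c)) (deriv f (l + c)) ∈ nhds (deriv f l) :=
    Ioo_mem_nhds (hmono (by linarith)) (hmono (by linarith))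
  filter_upwards [hnhds] with y hy
  obtain ⟨k, ⟨hk₁, hk₂⟩, rfl⟩ :=
    intermediate_value_Ioo (by linarith : l - c ≤ l + c) hcont.continuousOn hy
  simp only [legendreTransform_deriv hf hmono, EReal.toReal_coe, smul_eq_mul, Real.norm_eq_abs]
  have h₁ := add_deriv_mul_sub_le hf hmono k l
  have h₂ := add_deriv_mul_sub_le hf hmono l k
  have h₃ : |k - l| ≤ c := abs_le.2 ⟨by linarith, by linarith⟩
  calc _ ≤ |(k - l) * (deriv f k - deriv f l)| := by
        rw [abs_of_nonneg (by linarith)]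
        exact le_trans (by linarith) (le_abs_self _)
    _ ≤ c * |deriv f k - deriv f l| := by
        rw [abs_mul]
        gcongr

end LegendreTransform

namespace ProbabilityTheory

variable {Ω : Type*} [MeasurableSpace Ω] {P : Measure Ω} {X : Ω → ℝ}

lemma mem_interior_integrableExpSet_of_forall
    (hmgf : ∀ l : ℝ, Integrable (fun ω => Real.exp (l * X ω)) P) (l : ℝ) :
    l ∈ interior (integrableExpSet X P) := by
  have : integrableExpSet X P = univ := eq_univ_of_forall hmgf
  simp [this]

lemma differentiable_cgf (hmgf : ∀ l : ℝ, Integrable (fun ω => Real.exp (l * X ω)) P) :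
    Differentiable ℝ (cgf X P) := fun l =>
  (analyticAt_cgf (mem_interior_integrableExpSet_of_forall hmgf l)).differentiableAt

lemma continuous_deriv_cgf (hmgf : ∀ l : ℝ, Integrable (fun ω => Real.exp (l * X ω)) P) :
    Continuous (deriv (cgf X P)) :=
  continuous_iff_continuousAt.2 fun l =>
    (analyticAt_cgf (mem_interior_integrableExpSet_of_forall hmgf l)).deriv.continuousAt

variable [IsProbabilityMeasure P]

lemma strictMono_deriv_cgf (hmgf : ∀ l : ℝ, Integrable (fun ω => Real.exp (l * X ω)) P)
    (hnondeg : ∀ t : ℝ, ¬ X =ᵐ[P] fun _ => t) :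
    StrictMono (deriv (cgf X P)) := by
  refine strictMono_of_deriv_pos fun l => ?_
  have hl := mem_interior_integrableExpSet_of_forall hmgf l
  rw [← iteratedDeriv_one (f := cgf X P), ← iteratedDeriv_succ, ← variance_tilted_mul hl]
  refine (variance_nonneg _ _).lt_of_ne' fun hzero => ?_
  have : IsProbabilityMeasure (P.tilted (l * X ·)) := isProbabilityMeasure_tilted (hmgf l)
  have hconst := ae_eq_integral_of_variance_eq_zero (memLp_tilted_mul hl 2) hzero
  exact hnondeg _ ((absolutelyContinuous_tilted (hmgf l)).ae_le hconst)

lemma exists_lt_deriv_cgf (hmgf : ∀ l : ℝ, Integrable (fun ω => Real.exp (l * X ω)) P)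
    {x r : ℝ} (hxr : x < r) (hr : P {ω | r ≤ X ω} ≠ 0) : ∃ l, x < deriv (cgf X P) l := by
  set c := P.real {ω | r ≤ X ω}
  have hc : 0 < c := ENNReal.toReal_pos hr (measure_ne_top _ _)
  have hlog : Real.log c ≤ 0 := Real.log_nonpos hc.le measureReal_le_one
  set l := (1 - Real.log c) / (r - x)
  have hl : 0 < l := div_pos (by linarith) (sub_pos.2 hxr)
  have hmul : l * (r - x) = 1 - Real.log c := div_mul_cancel₀ _ (sub_pos.2 hxr).ne'
  have hchernoff : Real.log c ≤ -l * r + cgf X P l :=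
    (Real.log_le_iff_le_exp hc).2 (measure_ge_le_exp_cgf r hl.le (hmgf l))
  have hdiff := differentiable_cgf hmgf
  obtain ⟨k, -, hk⟩ := exists_deriv_eq_slope (cgf X P) hl hdiff.continuous.continuousOn
    hdiff.differentiableOn
  refine ⟨k, ?_⟩
  rw [hk, cgf_zero, sub_zero, sub_zero, lt_div_iff₀ hl]
  linarith

lemma exists_deriv_cgf_lt (hmgf : ∀ l : ℝ, Integrable (fun ω => Real.exp (l * X ω)) P)
    {x r : ℝ} (hrx : r < x) (hr : P {ω | X ω ≤ r} ≠ 0) : ∃ l, deriv (cgf X P) l < x := by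
  have hneg : cgf (-X) P = fun l => cgf X P (-l) := funext fun _ => cgf_neg
  obtain ⟨l, hl⟩ := exists_lt_deriv_cgf (P := P) (X := -X) (x := -x) (r := -r)
    (fun l => by simpa using hmgf (-l)) (neg_lt_neg hrx) (by simpa using hr)
  rw [hneg, deriv_comp_neg] at hl
  exact ⟨-l, neg_lt_neg_iff.1 hl⟩

lemma exists_deriv_cgf_eq (hmgf : ∀ l : ℝ, Integrable (fun ω => Real.exp (l * X ω)) P) {x : ℝ}
    (hlo : essInf (fun ω => (X ω : EReal)) P < (x : EReal))
    (hhi : (x : EReal) < essSup (fun ω => (X ω : EReal)) P) :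
    ∃ l, deriv (cgf X P) l = x := by
  obtain ⟨r, hr₁, hr₂⟩ := EReal.lt_iff_exists_real_btwn.1 hlo
  obtain ⟨s, hs₁, hs₂⟩ := EReal.lt_iff_exists_real_btwn.1 hhi
  have hr : P {ω | X ω ≤ r} ≠ 0 := fun h => hr₁.not_ge <| le_essInf_of_ae_le _ <| by
    filter_upwards [measure_eq_zero_iff_ae_notMem.1 h] with ω hω
    exact EReal.coe_le_coe_iff.2 (not_le.1 hω).le
  have hs : P {ω | s ≤ X ω} ≠ 0 := fun h => hs₂.not_ge <| essSup_le_of_ae_le _ <| by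
    filter_upwards [measure_eq_zero_iff_ae_notMem.1 h] with ω hω
    exact EReal.coe_le_coe_iff.2 (not_le.1 hω).le
  obtain ⟨a, ha⟩ := exists_deriv_cgf_lt hmgf (EReal.coe_lt_coe_iff.1 hr₂) hr
  obtain ⟨b, hb⟩ := exists_lt_deriv_cgf hmgf (EReal.coe_lt_coe_iff.1 hs₁) hs
  exact mem_range_of_exists_le_of_exists_ge (continuous_deriv_cgf hmgf) ⟨a, ha.le⟩ ⟨b, hb.le⟩

end ProbabilityTheory

/-- For every `x` with `essinf X < x < esssup X`, there is a unique `λ ∈ ℝ` with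
`φ'(λ) = x`; moreover `I(x) = λx − φ(λ)` and `I` is differentiable at `x` with
`I'(x) = λ`, i.e. `I' = (φ')⁻¹` on the interior of the effective domain of `I`. -/
theorem rate_function_derivative
    {Ω : Type*} [MeasurableSpace Ω] (P : Measure Ω) [IsProbabilityMeasure P]
    (X : Ω → ℝ) (hXmeas : Measurable X)
    (hnondeg : ∀ t : ℝ, P {ω | X ω = t} < 1)
    (hmgf : ∀ l : ℝ, Integrable (fun ω => Real.exp (l * X ω)) P)
    (φ : ℝ → ℝ) (hφ : φ = fun l => Real.log (∫ ω, Real.exp (l * X ω) ∂P))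
    (I : ℝ → EReal) (hI : I = fun x => ⨆ l : ℝ, ((l * x - φ l : ℝ) : EReal))
    (x : ℝ)
    (hlo : essInf (fun ω => (X ω : EReal)) P < (x : EReal))
    (hhi : (x : EReal) < essSup (fun ω => (X ω : EReal)) P) :
    ∃ l : ℝ, deriv φ l = x ∧ (∀ l' : ℝ, deriv φ l' = x → l' = l) ∧
      I x = ((l * x - φ l : ℝ) : EReal) ∧
      HasDerivAt (fun y => (I y).toReal) l x := by
  obtain rfl : φ = ProbabilityTheory.cgf X P := hφ
  obtain rfl : I = legendreTransform (ProbabilityTheory.cgf X P) := hI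
  have hnot (t : ℝ) : ¬ X =ᵐ[P] fun _ => t := fun h =>
    (hnondeg t).ne ((prob_compl_eq_zero_iff (hXmeas (measurableSet_singleton t))).1 h)
  have hdiff := ProbabilityTheory.differentiable_cgf hmgf
  have hmono := ProbabilityTheory.strictMono_deriv_cgf hmgf hnot
  obtain ⟨l, rfl⟩ := ProbabilityTheory.exists_deriv_cgf_eq hmgf hlo hhi
  exact ⟨l, rfl, fun l' h => hmono.injective h, legendreTransform_deriv hdiff hmono l,
    hasDerivAt_legendreTransform hdiff hmono (ProbabilityTheory.continuous_deriv_cgf hmgf) l⟩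
end

section
/- For every real number a ∈ [0,1] and every real number t ≥ 2, the inequality 1 − (1 − a)^t ≥ a t (1 − a t) holds. -/
/-- For every `a ∈ [0,1]` and every real `t ≥ 2`, `1 − (1 − a)^t ≥ at(1 − at)`,
where `(1 − a)^t` is the real power. -/
theorem one_sub_pow_ge (a t : ℝ) (ha : a ∈ Set.Icc (0 : ℝ) 1) (ht : 2 ≤ t) :
    a * t * (1 - a * t) ≤ 1 - (1 - a) ^ t := by
  obtain ⟨ha₀, ha₁⟩ := ha
  have hx : 0 ≤ a * t := mul_nonneg ha₀ (by linarith)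
  have hpow : (1 - a) ^ t ≤ Real.exp (-(a * t)) :=
    calc (1 - a) ^ t ≤ Real.exp (-a) ^ t :=
          Real.rpow_le_rpow (by linarith) (Real.one_sub_le_exp_neg a) (by linarith)
      _ = Real.exp (-(a * t)) := by rw [← Real.exp_mul, neg_mul]
  generalize a * t = x at hx hpow ⊢
  have hexp : Real.exp (-x) ≤ 1 - x + x ^ 2 := by
    rw [Real.exp_neg, inv_le_iff_one_le_mul₀ (Real.exp_pos x)]
    calc 1 ≤ (1 - x + x ^ 2) * (x + 1) := by linarith [pow_nonneg hx 3]
      _ ≤ (1 - x + x ^ 2) * Real.exp x :=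
          mul_le_mul_of_nonneg_left (Real.add_one_le_exp x) (by nlinarith [sq_nonneg (x - 1)])
  linarith
end
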